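/- Consider a partial tournament after Matchday 5, i.e., all ordered matches are played except two, and the two remaining matches involve all four teams (their unordered pairs of teams are disjoint). Fix either the goal-difference tiebreak or the head-to-head tiebreak. Then there exists M₀ ∈ ℕ such that for every natural number M ≥ M₀ the following holds: consider the four completions obtained by assigning to each of the two remaining matches a result from {(M,0), (0,M)} (the home team scores M and the away team 0, or vice versa). If the final position of a team i is the same value p in all four of these completions, then the final position of i equals p in every completion of the partial tournament. -/

import Mathlib

/-- Teams are the elements of `Fin 4`. -/
abbrev Team : Type := Fin 4

/-- A complete tournament assigns to each ordered pair `(i, j)` (with `i` at home)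
a result `(goals scored by i, goals scored by j)`.  Only values at pairs of
distinct teams are meaningful. -/
abbrev Tournament : Type := Team → Team → ℕ × ℕ

/-- Points obtained in a single match by a team scoring `g` goals and conceding `c`. -/
def matchPts (g c : ℕ) : ℕ := if c < g then 3 else if g = c then 1 else 0

/-- The set of all 12 ordered matches. -/
def allMatches : Finset (Team × Team) := Finset.univ.filter (fun m => m.1 ≠ m.2)

/-- Points of team `i` summed over the matches in `P` (the played matches). -/
def currentPts (P : Finset (Team × Team)) (T : Tournament) (i : Team) : ℕ :=
  ∑ m ∈ P,
    (if m.1 = i then matchPts (T m.1 m.2).1 (T m.1 m.2).2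
     else if m.2 = i then matchPts (T m.1 m.2).2 (T m.1 m.2).1
     else 0)

/-- Total points of team `i` in a complete tournament. -/
def totalPts (T : Tournament) (i : Team) : ℕ := currentPts allMatches T i

/-- Goal difference of team `i` in a complete tournament. -/
def goalDiff (T : Tournament) (i : Team) : ℤ :=
  ∑ m ∈ allMatches,
    (if m.1 = i then ((T m.1 m.2).1 : ℤ) - ((T m.1 m.2).2 : ℤ)
     else if m.2 = i then ((T m.1 m.2).2 : ℤ) - ((T m.1 m.2).1 : ℤ)
     else 0)

/-- Points obtained by team `i` in its two mutual matches against team `j`. -/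
def mutualPts (T : Tournament) (i j : Team) : ℕ :=
  matchPts (T i j).1 (T i j).2 + matchPts (T j i).2 (T j i).1

/-- Goal difference of team `i` in its two mutual matches against team `j`. -/
def mutualGD (T : Tournament) (i j : Team) : ℤ :=
  (((T i j).1 : ℤ) - ((T i j).2 : ℤ)) + (((T j i).2 : ℤ) - ((T j i).1 : ℤ))

/-- Goal-difference tiebreak: `i` is ranked strictly above `j`. -/
def RankedAboveGD (T : Tournament) (i j : Team) : Prop :=
  totalPts T j < totalPts T i ∨
    (totalPts T i = totalPts T j ∧ goalDiff T j < goalDiff T i)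

/-- Head-to-head tiebreak: `i` is ranked strictly above `j`. -/
def RankedAboveH2H (T : Tournament) (i j : Team) : Prop :=
  totalPts T j < totalPts T i ∨
    (totalPts T i = totalPts T j ∧ mutualPts T j i < mutualPts T i j) ∨
    (totalPts T i = totalPts T j ∧ mutualPts T i j = mutualPts T j i ∧
      mutualGD T j i < mutualGD T i j)

open Classical in
/-- Final position of team `i` under the goal-difference tiebreak. -/
noncomputable def finalPosGD (T : Tournament) (i : Team) : ℕ :=
  1 + (Finset.univ.filter (fun j => RankedAboveGD T j i)).card

open Classical in
/-- Final position of team `i` under the head-to-head tiebreak. -/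
noncomputable def finalPosH2H (T : Tournament) (i : Team) : ℕ :=
  1 + (Finset.univ.filter (fun j => RankedAboveH2H T j i)).card

/-- `T'` is a completion of the partial tournament `(P, T)`. -/
def Completes (P : Finset (Team × Team)) (T T' : Tournament) : Prop :=
  ∀ m ∈ P, T' m.1 m.2 = T m.1 m.2

/-- The set `P` of played matches corresponds to the situation after Matchday 4:
every unordered pair of distinct teams has at least one of its ordered matches
played, and exactly two unordered pairs — which are disjoint, forming a perfect
matching of the four teams — have both of their ordered matches played. -/
def AfterMD4 (P : Finset (Team × Team)) : Prop :=
  (∀ m ∈ P, m.1 ≠ m.2) ∧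
  (∀ i j : Team, i ≠ j → (i, j) ∈ P ∨ (j, i) ∈ P) ∧
  ∃ a b c d : Team,
    ({a, b, c, d} : Finset Team) = Finset.univ ∧
    (a, b) ∈ P ∧ (b, a) ∈ P ∧ (c, d) ∈ P ∧ (d, c) ∈ P ∧
    ∀ i j : Team, (i, j) ∈ P → (j, i) ∈ P →
      ({i, j} : Finset Team) = {a, b} ∨ ({i, j} : Finset Team) = {c, d}

/-- Replace the result of the single match `m` by `r`. -/
def assign (T : Tournament) (m : Team × Team) (r : ℕ × ℕ) : Tournament :=
  fun i j => if (i, j) = m then r else T i j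

/-- Two matches between distinct teams that have no team in common. -/
structure DisjointMatches (m₁ m₂ : Team × Team) : Prop where
  ne_left : m₁.1 ≠ m₁.2
  ne_right : m₂.1 ≠ m₂.2
  home_home : m₁.1 ≠ m₂.1
  home_away : m₁.1 ≠ m₂.2
  away_home : m₁.2 ≠ m₂.1
  away_away : m₁.2 ≠ m₂.2

/-- The matches other than `m₁` and `m₂`. -/
abbrev played (m₁ m₂ : Team × Team) : Finset (Team × Team) := allMatches \ {m₁, m₂}

/-- Goal difference of team `i` over the matches in `P`. -/
def currentGD (P : Finset (Team × Team)) (T : Tournament) (i : Team) : ℤ :=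
  ∑ m ∈ P,
    (if m.1 = i then ((T m.1 m.2).1 : ℤ) - ((T m.1 m.2).2 : ℤ)
     else if m.2 = i then ((T m.1 m.2).2 : ℤ) - ((T m.1 m.2).1 : ℤ)
     else 0)

/-- `m` is a match between `x` and `y`, at either ground. -/
def IsMatchOf (m : Team × Team) (x y : Team) : Prop := m = (x, y) ∨ m = (y, x)

/-- In `U`, the match `m` is won by `w` against `l` with score `M : 0`. -/
def WonBy (m : Team × Team) (M : ℕ) (U : Tournament) (w l : Team) : Prop :=
  (m = (w, l) ∧ U w l = (M, 0)) ∨ (m = (l, w) ∧ U l w = (0, M))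

/-- In `U`, team `j` wins one of the matches `m₁`, `m₂` with score `M : 0`. -/
def Wins (m₁ m₂ : Team × Team) (M : ℕ) (U : Tournament) (j : Team) : Prop :=
  ∃ x, WonBy m₁ M U j x ∨ WonBy m₂ M U j x

/-- In `U`, team `j` loses one of the matches `m₁`, `m₂` with score `0 : M`. -/
def Loses (m₁ m₂ : Team × Team) (M : ℕ) (U : Tournament) (j : Team) : Prop :=
  ∃ x, WonBy m₁ M U x j ∨ WonBy m₂ M U x j

section

variable {m₁ m₂ : Team × Team} {T U V : Tournament} {M : ℕ} {i j : Team}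

theorem matchPts_le_three (g c : ℕ) : matchPts g c ≤ 3 := by
  unfold matchPts; split_ifs <;> omega

theorem matchPts_of_lt {g c : ℕ} (h : c < g) : matchPts g c = 3 := by
  simp [matchPts, h]

theorem matchPts_of_gt {g c : ℕ} (h : g < c) : matchPts g c = 0 := by
  unfold matchPts; split_ifs <;> omega

namespace DisjointMatches

theorem of_cover (h₁ : m₁.1 ≠ m₁.2) (h₂ : m₂.1 ≠ m₂.2)
    (hall : ({m₁.1, m₁.2, m₂.1, m₂.2} : Finset Team) = Finset.univ) :
    DisjointMatches m₁ m₂ := by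
  have key : ∀ a b c d : Team, ({a, b, c, d} : Finset Team) = Finset.univ →
      a ≠ c ∧ a ≠ d ∧ b ≠ c ∧ b ≠ d := by decide
  obtain ⟨h₃, h₄, h₅, h₆⟩ := key _ _ _ _ hall
  exact ⟨h₁, h₂, h₃, h₄, h₅, h₆⟩

theorem symm (h : DisjointMatches m₁ m₂) : DisjointMatches m₂ m₁ :=
  ⟨h.ne_right, h.ne_left, h.home_home.symm, h.away_home.symm, h.home_away.symm,
    h.away_away.symm⟩

theorem ne (h : DisjointMatches m₁ m₂) : m₁ ≠ m₂ := fun e => h.home_home (by rw [e])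

/-- A sum over all matches splits off the two disjoint matches. -/
theorem sum_allMatches {α : Type*} [AddCommMonoid α] (h : DisjointMatches m₁ m₂)
    (f : Team × Team → α) :
    ∑ m ∈ allMatches, f m = ∑ m ∈ played m₁ m₂, f m + (f m₁ + f m₂) := by
  have hsub : ({m₁, m₂} : Finset (Team × Team)) ⊆ allMatches := by
    intro m hm
    simp only [Finset.mem_insert, Finset.mem_singleton] at hm
    rcases hm with rfl | rfl
    · simpa [allMatches] using h.ne_left
    · simpa [allMatches] using h.ne_right
  rw [← Finset.sum_sdiff hsub, Finset.sum_pair h.ne]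

theorem totalPts_eq (h : DisjointMatches m₁ m₂) (hU : Completes (played m₁ m₂) T U)
    (j : Team) :
    totalPts U j = currentPts (played m₁ m₂) T j +
      ((if m₁.1 = j then matchPts (U m₁.1 m₁.2).1 (U m₁.1 m₁.2).2
        else if m₁.2 = j then matchPts (U m₁.1 m₁.2).2 (U m₁.1 m₁.2).1 else 0) +
      (if m₂.1 = j then matchPts (U m₂.1 m₂.2).1 (U m₂.1 m₂.2).2
        else if m₂.2 = j then matchPts (U m₂.1 m₂.2).2 (U m₂.1 m₂.2).1 else 0)) := by
  unfold totalPts currentPts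
  rw [h.sum_allMatches]
  congr 1
  exact Finset.sum_congr rfl fun m hm => by rw [hU m hm]

theorem goalDiff_eq (h : DisjointMatches m₁ m₂) (hU : Completes (played m₁ m₂) T U)
    (j : Team) :
    goalDiff U j = currentGD (played m₁ m₂) T j +
      ((if m₁.1 = j then ((U m₁.1 m₁.2).1 : ℤ) - (U m₁.1 m₁.2).2
        else if m₁.2 = j then ((U m₁.1 m₁.2).2 : ℤ) - (U m₁.1 m₁.2).1 else 0) +
      (if m₂.1 = j then ((U m₂.1 m₂.2).1 : ℤ) - (U m₂.1 m₂.2).2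
        else if m₂.2 = j then ((U m₂.1 m₂.2).2 : ℤ) - (U m₂.1 m₂.2).1 else 0)) := by
  unfold goalDiff currentGD
  rw [h.sum_allMatches]
  congr 1
  exact Finset.sum_congr rfl fun m hm => by rw [hU m hm]

theorem totalPts_bounds (h : DisjointMatches m₁ m₂) (hU : Completes (played m₁ m₂) T U)
    (j : Team) :
    currentPts (played m₁ m₂) T j ≤ totalPts U j ∧
      totalPts U j ≤ currentPts (played m₁ m₂) T j + 3 := by
  rw [h.totalPts_eq hU j]
  obtain ⟨h₁, h₂, h₃, h₄, h₅, h₆⟩ := h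
  have a := matchPts_le_three (U m₁.1 m₁.2).1 (U m₁.1 m₁.2).2
  have b := matchPts_le_three (U m₁.1 m₁.2).2 (U m₁.1 m₁.2).1
  have c := matchPts_le_three (U m₂.1 m₂.2).1 (U m₂.1 m₂.2).2
  have d := matchPts_le_three (U m₂.1 m₂.2).2 (U m₂.1 m₂.2).1
  split_ifs <;> first | omega | simp_all

theorem of_wins (h : DisjointMatches m₁ m₂) (hM : 0 < M)
    (hU : Completes (played m₁ m₂) T U) (hj : Wins m₁ m₂ M U j) :
    totalPts U j = currentPts (played m₁ m₂) T j + 3 ∧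
      goalDiff U j = currentGD (played m₁ m₂) T j + M := by
  rw [h.totalPts_eq hU j, h.goalDiff_eq hU j]
  obtain ⟨h₁, h₂, h₃, h₄, h₅, h₆⟩ := h
  obtain ⟨x, (⟨rfl, hx⟩ | ⟨rfl, hx⟩) | (⟨rfl, hx⟩ | ⟨rfl, hx⟩)⟩ := hj <;>
    simp_all [matchPts_of_lt, eq_comm]

theorem of_loses (h : DisjointMatches m₁ m₂) (hM : 0 < M)
    (hU : Completes (played m₁ m₂) T U) (hj : Loses m₁ m₂ M U j) :
    totalPts U j = currentPts (played m₁ m₂) T j ∧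
      goalDiff U j = currentGD (played m₁ m₂) T j - M := by
  rw [h.totalPts_eq hU j, h.goalDiff_eq hU j]
  obtain ⟨h₁, h₂, h₃, h₄, h₅, h₆⟩ := h
  obtain ⟨x, (⟨rfl, hx⟩ | ⟨rfl, hx⟩) | (⟨rfl, hx⟩ | ⟨rfl, hx⟩)⟩ := hj <;>
    simp_all [matchPts_of_gt, eq_comm, sub_eq_add_neg]

end DisjointMatches

/-- Properties of a ranking rule `A` (with `A U j i` meaning that `j` is above `i` in `U`)
under which the scenarios with score `M : 0` are extreme. -/
structure ExtremeAt (A : Tournament → Team → Team → Prop) (T : Tournament)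
    (m₁ m₂ : Team × Team) (M : ℕ) : Prop where
  irrefl : ∀ U j, ¬ A U j j
  of_worst : ∀ U V i j, Completes (played m₁ m₂) T U → Completes (played m₁ m₂) T V →
    Loses m₁ m₂ M U j → Wins m₁ m₂ M U i → A U j i → A V j i
  to_best : ∀ U V i j, Completes (played m₁ m₂) T U → Completes (played m₁ m₂) T V →
    Wins m₁ m₂ M V j → Loses m₁ m₂ M V i → A U j i → A V j i
  of_parallel : ∀ U V i j, Completes (played m₁ m₂) T U → Completes (played m₁ m₂) T V →
    Wins m₁ m₂ M U j → Wins m₁ m₂ M U i → Loses m₁ m₂ M V j → Loses m₁ m₂ M V i →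
    A U j i → A V j i

theorem ExtremeAt.symm {A : Tournament → Team → Team → Prop}
    (h : ExtremeAt A T m₁ m₂ M) : ExtremeAt A T m₂ m₁ M := by
  have hw : ∀ U j, Wins m₂ m₁ M U j ↔ Wins m₁ m₂ M U j := fun U j => by
    simp only [Wins, or_comm]
  have hl : ∀ U j, Loses m₂ m₁ M U j ↔ Loses m₁ m₂ M U j := fun U j => by
    simp only [Loses, or_comm]
  have hp : played m₂ m₁ = played m₁ m₂ := by simp only [played, Finset.pair_comm]
  obtain ⟨a, b, c, d⟩ := h
  constructor <;> simpa only [hw, hl, hp]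

theorem extremeAt_goalDiff (h : DisjointMatches m₁ m₂)
    (hM : 1 + ∑ j, (currentGD (played m₁ m₂) T j).natAbs ≤ M) :
    ExtremeAt RankedAboveGD T m₁ m₂ M := by
  have hM₀ : 0 < M := by omega
  have hb : ∀ j, (currentGD (played m₁ m₂) T j).natAbs < M := fun j => by
    have := Finset.single_le_sum (f := fun j => (currentGD (played m₁ m₂) T j).natAbs)
      (fun _ _ => Nat.zero_le _) (Finset.mem_univ j)
    omega
  refine ⟨?_, ?_, ?_, ?_⟩
  · intro U j
    simp [RankedAboveGD]
  · intro U V i j hU hV hj hi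
    have := h.of_loses hM₀ hU hj
    have := h.of_wins hM₀ hU hi
    have := h.totalPts_bounds hV i
    have := h.totalPts_bounds hV j
    have := hb i
    have := hb j
    unfold RankedAboveGD
    omega
  · intro U V i j hU hV hj hi
    have := h.of_wins hM₀ hV hj
    have := h.of_loses hM₀ hV hi
    have := h.totalPts_bounds hU i
    have := h.totalPts_bounds hU j
    have := hb i
    have := hb j
    unfold RankedAboveGD
    omega
  · intro U V i j hU hV hj hi hj' hi'
    have := h.of_wins hM₀ hU hj
    have := h.of_wins hM₀ hU hi
    have := h.of_loses hM₀ hV hj'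
    have := h.of_loses hM₀ hV hi'
    unfold RankedAboveGD
    omega

theorem Completes.eq_of_ne (hU : Completes (played m₁ m₂) T U) (hij : i ≠ j)
    (h₁ : m₁ ≠ (i, j)) (h₂ : m₂ ≠ (i, j)) : U i j = T i j :=
  hU (i, j) (by simp [allMatches, hij, h₁.symm, h₂.symm])

/-- Two distinct teams either face each other in one of the two matches, or their mutual
results agree in all completions. -/
theorem Completes.mutual_eq_or (hU : Completes (played m₁ m₂) T U)
    (hV : Completes (played m₁ m₂) T V) (hij : i ≠ j) :
    (IsMatchOf m₁ i j ∨ IsMatchOf m₂ i j) ∨ (U i j = V i j ∧ U j i = V j i) := by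
  by_cases h : IsMatchOf m₁ i j ∨ IsMatchOf m₂ i j
  · exact Or.inl h
  · simp only [IsMatchOf, not_or] at h
    obtain ⟨⟨h₁, h₂⟩, h₃, h₄⟩ := h
    refine Or.inr ⟨?_, ?_⟩
    · rw [hU.eq_of_ne hij h₁ h₃, hV.eq_of_ne hij h₁ h₃]
    · rw [hU.eq_of_ne hij.symm h₂ h₄, hV.eq_of_ne hij.symm h₂ h₄]

/-- A winner facing a loser in one of two disjoint matches is at least level on mutual points
and strictly ahead on mutual goal difference, once the score is large enough. -/
theorem DisjointMatches.mutual_of_wins (h : DisjointMatches m₁ m₂)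
    (hM : ∀ i j, (T i j).1 + (T i j).2 < M) (hU : Completes (played m₁ m₂) T U)
    (hf : IsMatchOf m₁ i j ∨ IsMatchOf m₂ i j) (hi : Wins m₁ m₂ M U i) :
    mutualPts U j i ≤ mutualPts U i j ∧ mutualGD U j i < mutualGD U i j := by
  have hM₀ : 0 < M := (Nat.zero_le _).trans_lt (hM i j)
  have hij : i ≠ j := by
    rintro rfl
    rcases hf with (rfl | rfl) | (rfl | rfl)
    exacts [h.ne_left rfl, h.ne_left rfl, h.ne_right rfl, h.ne_right rfl]
  have hval : (U i j = (M, 0) ∧ U j i = T j i) ∨ (U j i = (0, M) ∧ U i j = T i j) := by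
    have e₁ := hU.eq_of_ne (i := i) (j := j) hij
    have e₂ := hU.eq_of_ne (i := j) (j := i) hij.symm
    obtain ⟨h₁, h₂, h₃, h₄, h₅, h₆⟩ := h
    obtain ⟨x, (⟨rfl, hx⟩ | ⟨rfl, hx⟩) | (⟨rfl, hx⟩ | ⟨rfl, hx⟩)⟩ := hi <;>
      simp only [IsMatchOf, Prod.mk.injEq] at hf <;> grind
  have bij := hM i j
  have bji := hM j i
  unfold mutualPts mutualGD
  rcases hval with ⟨e, e'⟩ | ⟨e, e'⟩ <;> rw [e, e']
  · have := matchPts_le_three (T j i).1 (T j i).2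
    simp only [matchPts_of_lt hM₀, matchPts_of_gt hM₀]
    omega
  · have := matchPts_le_three (T i j).2 (T i j).1
    simp only [matchPts_of_lt hM₀, matchPts_of_gt hM₀]
    omega

theorem extremeAt_headToHead (h : DisjointMatches m₁ m₂)
    (hM : ∀ i j, (T i j).1 + (T i j).2 < M) : ExtremeAt RankedAboveH2H T m₁ m₂ M := by
  have hM₀ : 0 < M := (Nat.zero_le _).trans_lt (hM 0 0)
  have irr : ∀ U j, ¬ RankedAboveH2H U j j := fun U j => by simp [RankedAboveH2H]
  refine ⟨irr, ?_, ?_, ?_⟩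
  · intro U V i j hU hV hj hi hA
    rcases eq_or_ne i j with rfl | hij
    · exact (irr _ _ hA).elim
    have := h.of_loses hM₀ hU hj
    have := h.of_wins hM₀ hU hi
    have := h.totalPts_bounds hV i
    have := h.totalPts_bounds hV j
    unfold RankedAboveH2H at hA ⊢
    rcases hU.mutual_eq_or hV hij with hf | ⟨e, e'⟩
    · have := h.mutual_of_wins hM hU hf hi
      omega
    · simp only [mutualPts, mutualGD, e, e'] at hA ⊢
      omega
  · intro U V i j hU hV hj hi hA
    rcases eq_or_ne j i with rfl | hij
    · exact (irr _ _ hA).elim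
    have := h.of_loses hM₀ hV hi
    have := h.of_wins hM₀ hV hj
    have := h.totalPts_bounds hU i
    have := h.totalPts_bounds hU j
    unfold RankedAboveH2H at hA ⊢
    rcases hU.mutual_eq_or hV hij with hf | ⟨e, e'⟩
    · have := h.mutual_of_wins hM hV hf hj
      omega
    · simp only [mutualPts, mutualGD, e, e'] at hA ⊢
      omega
  · intro U V i j hU hV hj hi hj' hi' hA
    rcases eq_or_ne i j with rfl | hij
    · exact (irr _ _ hA).elim
    have := h.of_wins hM₀ hU hj
    have := h.of_wins hM₀ hU hi
    have := h.of_loses hM₀ hV hj'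
    have := h.of_loses hM₀ hV hi'
    unfold RankedAboveH2H at hA ⊢
    rcases hU.mutual_eq_or hV hij with hf | ⟨e, e'⟩
    · have a := h.mutual_of_wins hM hU hf hi
      have b := h.mutual_of_wins hM hU (i := j) (j := i)
        (hf.imp Or.symm Or.symm) hj
      omega
    · simp only [mutualPts, mutualGD, e, e'] at hA ⊢
      omega

theorem Finset.eq_of_squeeze {α : Type*} {S₁ S₂ S₃ S₄ S : Finset α}
    (h₁₂ : S₁ ⊆ S₂) (h₃₄ : S₃ ⊆ S₄) (c₁₂ : S₁.card = S₂.card) (c₃₄ : S₃.card = S₄.card)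
    (h : ∀ j, ((j ∈ S₁ → j ∈ S) ∧ (j ∈ S → j ∈ S₂)) ∨
      ((j ∈ S₃ → j ∈ S₁ ∧ j ∈ S) ∧ (j ∈ S₁ ∨ j ∈ S → j ∈ S₄))) : S = S₁ := by
  have e₁₂ := Finset.eq_of_subset_of_card_le h₁₂ c₁₂.ge
  have e₃₄ := Finset.eq_of_subset_of_card_le h₃₄ c₃₄.ge
  subst e₁₂ e₃₄
  ext j
  have := h j
  tauto

open Classical in
/-- If team `i` plays `m₁` and its number of superiors is the same in the four extreme
scenarios, it is the same in every completion. -/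
theorem ExtremeAt.card_eq {A : Tournament → Team → Team → Prop}
    (hA : ExtremeAt A T m₁ m₂ M) {o c d : Team} {n : ℕ}
    (hcover : ({i, o, c, d} : Finset Team) = Finset.univ)
    (h₁ : IsMatchOf m₁ i o) (h₂ : IsMatchOf m₂ c d)
    (hex : ∀ x y z w, IsMatchOf m₁ x y → IsMatchOf m₂ z w →
      ∃ U, Completes (played m₁ m₂) T U ∧ WonBy m₁ M U x y ∧ WonBy m₂ M U z w ∧
        (Finset.univ.filter (fun j => A U j i)).card = n)
    (hV : Completes (played m₁ m₂) T V) :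
    (Finset.univ.filter (fun j => A V j i)).card = n := by
  obtain ⟨U₁, hU₁, a₁, b₁, c₁⟩ := hex i o d c h₁ h₂.symm
  obtain ⟨U₂, hU₂, a₂, b₂, c₂⟩ := hex o i c d h₁.symm h₂
  obtain ⟨U₃, hU₃, a₃, b₃, c₃⟩ := hex i o c d h₁ h₂
  obtain ⟨U₄, hU₄, a₄, b₄, c₄⟩ := hex o i d c h₁.symm h₂.symm
  have hteams : ∀ j, j = i ∨ j = o ∨ j = c ∨ j = d := fun j => by
    simpa using hcover.ge (Finset.mem_univ j)
  have hS : Finset.univ.filter (fun j => A V j i) = Finset.univ.filter (fun j => A U₁ j i) := by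
    apply Finset.eq_of_squeeze (S₂ := Finset.univ.filter (fun j => A U₂ j i))
      (S₃ := Finset.univ.filter (fun j => A U₃ j i))
      (S₄ := Finset.univ.filter (fun j => A U₄ j i)) ?_ ?_ (c₁.trans c₂.symm)
      (c₃.trans c₄.symm)
    · intro j
      simp only [Finset.mem_filter, Finset.mem_univ, true_and]
      rcases hteams j with rfl | rfl | rfl | rfl
      · simp [hA.irrefl]
      · exact .inl ⟨hA.of_worst _ _ _ _ hU₁ hV ⟨_, .inl a₁⟩ ⟨_, .inl a₁⟩,
          hA.to_best _ _ _ _ hV hU₂ ⟨_, .inl a₂⟩ ⟨_, .inl a₂⟩⟩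
      · exact .inl ⟨hA.of_worst _ _ _ _ hU₁ hV ⟨_, .inr b₁⟩ ⟨_, .inl a₁⟩,
          hA.to_best _ _ _ _ hV hU₂ ⟨_, .inr b₂⟩ ⟨_, .inl a₂⟩⟩
      · refine .inr ⟨fun hj => ⟨?_, ?_⟩, fun hj => hj.elim ?_ ?_⟩
        · exact hA.of_worst _ _ _ _ hU₃ hU₁ ⟨_, .inr b₃⟩ ⟨_, .inl a₃⟩ hj
        · exact hA.of_worst _ _ _ _ hU₃ hV ⟨_, .inr b₃⟩ ⟨_, .inl a₃⟩ hj
        · exact hA.to_best _ _ _ _ hU₁ hU₄ ⟨_, .inr b₄⟩ ⟨_, .inl a₄⟩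
        · exact hA.to_best _ _ _ _ hV hU₄ ⟨_, .inr b₄⟩ ⟨_, .inl a₄⟩
    · intro j
      simp only [Finset.mem_filter, Finset.mem_univ, true_and]
      rcases hteams j with rfl | rfl | rfl | rfl
      · simp [hA.irrefl]
      · exact hA.of_worst _ _ _ _ hU₁ hU₂ ⟨_, .inl a₁⟩ ⟨_, .inl a₁⟩
      · exact hA.of_worst _ _ _ _ hU₁ hU₂ ⟨_, .inr b₁⟩ ⟨_, .inl a₁⟩
      · exact hA.of_parallel _ _ _ _ hU₁ hU₂ ⟨_, .inr b₁⟩ ⟨_, .inl a₁⟩ ⟨_, .inr b₂⟩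
          ⟨_, .inl a₂⟩
    · intro j
      simp only [Finset.mem_filter, Finset.mem_univ, true_and]
      rcases hteams j with rfl | rfl | rfl | rfl
      · simp [hA.irrefl]
      · exact hA.of_worst _ _ _ _ hU₃ hU₄ ⟨_, .inl a₃⟩ ⟨_, .inl a₃⟩
      · exact hA.of_parallel _ _ _ _ hU₃ hU₄ ⟨_, .inr b₃⟩ ⟨_, .inl a₃⟩ ⟨_, .inr b₄⟩
          ⟨_, .inl a₄⟩
      · exact hA.of_worst _ _ _ _ hU₃ hU₄ ⟨_, .inr b₃⟩ ⟨_, .inl a₃⟩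
  rw [hS, c₁]

theorem completes_assign (r₁ r₂ : ℕ × ℕ) :
    Completes (played m₁ m₂) T (assign (assign T m₁ r₁) m₂ r₂) := by
  intro m hm
  simp only [Finset.mem_sdiff, Finset.mem_insert, Finset.mem_singleton, not_or] at hm
  simp [assign, hm.2.1, hm.2.2]

/-- Every choice of winners of the two matches is realised by one of the extreme scenarios. -/
theorem exists_extreme_scenario (h : m₁ ≠ m₂) {Q : Tournament → Prop}
    (hQ : ∀ r₁ ∈ ({(M, 0), (0, M)} : Finset (ℕ × ℕ)),
      ∀ r₂ ∈ ({(M, 0), (0, M)} : Finset (ℕ × ℕ)), Q (assign (assign T m₁ r₁) m₂ r₂))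
    {x y z w : Team} (h₁ : IsMatchOf m₁ x y) (h₂ : IsMatchOf m₂ z w) :
    ∃ U, Completes (played m₁ m₂) T U ∧ WonBy m₁ M U x y ∧ WonBy m₂ M U z w ∧ Q U := by
  have key : ∀ r₁ r₂, assign (assign T m₁ r₁) m₂ r₂ m₁.1 m₁.2 = r₁ ∧
      assign (assign T m₁ r₁) m₂ r₂ m₂.1 m₂.2 = r₂ := fun r₁ r₂ => by
    simp [assign, h]
  obtain ⟨r₁, hr₁, w₁⟩ : ∃ r₁ ∈ ({(M, 0), (0, M)} : Finset (ℕ × ℕ)),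
      ∀ U : Tournament, U m₁.1 m₁.2 = r₁ → WonBy m₁ M U x y := by
    rcases h₁ with rfl | rfl
    · exact ⟨(M, 0), by simp, fun U hU => .inl ⟨rfl, hU⟩⟩
    · exact ⟨(0, M), by simp, fun U hU => .inr ⟨rfl, hU⟩⟩
  obtain ⟨r₂, hr₂, w₂⟩ : ∃ r₂ ∈ ({(M, 0), (0, M)} : Finset (ℕ × ℕ)),
      ∀ U : Tournament, U m₂.1 m₂.2 = r₂ → WonBy m₂ M U z w := by
    rcases h₂ with rfl | rfl
    · exact ⟨(M, 0), by simp, fun U hU => .inl ⟨rfl, hU⟩⟩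
    · exact ⟨(0, M), by simp, fun U hU => .inr ⟨rfl, hU⟩⟩
  exact ⟨_, completes_assign r₁ r₂, w₁ _ (key r₁ r₂).1, w₂ _ (key r₁ r₂).2,
    hQ r₁ hr₁ r₂ hr₂⟩

open Classical in
theorem ExtremeAt.position_eq {A : Tournament → Team → Team → Prop}
    (hA : ExtremeAt A T m₁ m₂ M) (h : m₁ ≠ m₂)
    (hall : ({m₁.1, m₁.2, m₂.1, m₂.2} : Finset Team) = Finset.univ) {p : ℕ}
    (hp : ∀ r₁ ∈ ({(M, 0), (0, M)} : Finset (ℕ × ℕ)),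
      ∀ r₂ ∈ ({(M, 0), (0, M)} : Finset (ℕ × ℕ)),
        1 + (Finset.univ.filter
          (fun j => A (assign (assign T m₁ r₁) m₂ r₂) j i)).card = p)
    (hV : Completes (played m₁ m₂) T V) :
    1 + (Finset.univ.filter (fun j => A V j i)).card = p := by
  have hex := fun x y z w (h₁ : IsMatchOf m₁ x y) (h₂ : IsMatchOf m₂ z w) =>
    exists_extreme_scenario (T := T) (M := M) h
      (Q := fun U => (Finset.univ.filter (fun j => A U j i)).card = p - 1)
      (fun r₁ hr₁ r₂ hr₂ => by have := hp r₁ hr₁ r₂ hr₂; omega) h₁ h₂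
  have hpos : 1 ≤ p := by
    have := hp (M, 0) (by simp) (M, 0) (by simp)
    omega
  have hcomm : played m₂ m₁ = played m₁ m₂ := by simp only [played, Finset.pair_comm]
  have hex' : ∀ x y z w, IsMatchOf m₂ x y → IsMatchOf m₁ z w →
      ∃ U, Completes (played m₂ m₁) T U ∧ WonBy m₂ M U x y ∧ WonBy m₁ M U z w ∧
        (Finset.univ.filter (fun j => A U j i)).card = p - 1 := fun x y z w h₁ h₂ => by
    obtain ⟨U, a, b, c, e⟩ := hex z w x y h₂ h₁
    exact ⟨U, by rwa [hcomm], c, b, e⟩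
  have hV' : Completes (played m₂ m₁) T V := by rwa [hcomm]
  have hi : i = m₁.1 ∨ i = m₁.2 ∨ i = m₂.1 ∨ i = m₂.2 := by
    simpa using hall.ge (Finset.mem_univ i)
  have perm : ∀ S : Finset Team, ({m₁.1, m₁.2, m₂.1, m₂.2} : Finset Team) = S →
      S = Finset.univ := fun S hS => hS ▸ hall
  suffices (Finset.univ.filter (fun j => A V j i)).card = p - 1 by omega
  rcases hi with rfl | rfl | rfl | rfl
  · exact hA.card_eq hall (.inl rfl) (.inl rfl) hex hV
  · exact hA.card_eq (perm _ (by ext; simp; tauto)) (.inr rfl) (.inl rfl) hex hV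
  · exact hA.symm.card_eq (perm _ (by ext; simp; tauto)) (.inl rfl) (.inl rfl) hex' hV'
  · exact hA.symm.card_eq (perm _ (by ext; simp; tauto)) (.inr rfl) (.inl rfl) hex' hV'

end

/-- After Matchday 5 (all matches played except two, which
together involve all four teams), for either tiebreak rule there is an `M₀`
such that for every `M ≥ M₀`: if the final position of a team `i` equals `p`
in all four completions assigning results from `{(M,0), (0,M)}` to the two
remaining matches, then the final position of `i` equals `p` in every
completion. -/
theorem position_determined_after_MD5_iff_extreme_scenarios
    (T : Tournament) (m₁ m₂ : Team × Team)
    (hm₁ : m₁.1 ≠ m₁.2) (hm₂ : m₂.1 ≠ m₂.2)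
    (hall : ({m₁.1, m₁.2, m₂.1, m₂.2} : Finset Team) = Finset.univ) :
    (∃ M₀ : ℕ, ∀ M : ℕ, M₀ ≤ M → ∀ (i : Team) (p : ℕ),
      (∀ r₁ ∈ ({(M, 0), (0, M)} : Finset (ℕ × ℕ)),
        ∀ r₂ ∈ ({(M, 0), (0, M)} : Finset (ℕ × ℕ)),
          finalPosGD (assign (assign T m₁ r₁) m₂ r₂) i = p) →
      ∀ T' : Tournament, Completes (allMatches \ {m₁, m₂}) T T' →
        finalPosGD T' i = p) ∧
    (∃ M₀ : ℕ, ∀ M : ℕ, M₀ ≤ M → ∀ (i : Team) (p : ℕ),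
      (∀ r₁ ∈ ({(M, 0), (0, M)} : Finset (ℕ × ℕ)),
        ∀ r₂ ∈ ({(M, 0), (0, M)} : Finset (ℕ × ℕ)),
          finalPosH2H (assign (assign T m₁ r₁) m₂ r₂) i = p) →
      ∀ T' : Tournament, Completes (allMatches \ {m₁, m₂}) T T' →
        finalPosH2H T' i = p) := by
  have h := DisjointMatches.of_cover hm₁ hm₂ hall
  refine ⟨⟨_, fun M hM i p hp T' hT' =>
      (extremeAt_goalDiff h hM).position_eq h.ne hall hp hT'⟩,
    ⟨1 + ∑ i, ∑ j, ((T i j).1 + (T i j).2), fun M hM i p hp T' hT' =>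
      (extremeAt_headToHead h fun a b => ?_).position_eq h.ne hall hp hT'⟩⟩
  have hb := Finset.single_le_sum (f := fun j => (T a j).1 + (T a j).2)
    (fun _ _ => Nat.zero_le _) (Finset.mem_univ b)
  have ha := Finset.single_le_sum (f := fun i => ∑ j, ((T i j).1 + (T i j).2))
    (fun _ _ => Nat.zero_le _) (Finset.mem_univ a)
  omega
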